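/- (Odd case, second class.) Let n be odd, and set r_2 = \lfloor C(n,(n-1)/2) 2^{-(n+1)/2} \rfloor, v_2 = \lfloor C(n,(n+3)/2) 2^{-(n+3)/2} \rfloor, z_2 = \lfloor (C(n,(n+1)/2) + r_2 (n-1)/2 - v_2 (n+3)/2)/2 \rfloor. Let T_2(n) be the set of monotone Boolean functions f of n variables such that: every minimal one of f lies in E^{n,(n-1)/2}, E^{n,(n+1)/2}, or E^{n,(n+3)/2}; f(x) = 1 for every x with at least (n+5)/2 ones; f has exactly r_2 minimal ones in E^{n,(n-1)/2}; f has exactly v_2 maximal zeros in E^{n,(n+3)/2}; and f takes the value 1 on exactly z_2 vectors of E^{n,(n+1)/2}. Define Q(n) = C(n,(n+1)/2)^{-1} \cdot (1/2)( C(n,(n+1)/2) + C(n,(n-1)/2) 2^{-(n+1)/2} (n-1)/2 - C(n,(n+3)/2) 2^{-(n+3)/2} (n+3)/2 ) and \hat{s}_2(n) = n 2^{-n+1} [ (1/2) C(n,(n-1)/2) 2^{-(n+1)/2} + (1/2) C(n,(n-1)/2)(1 - 2^{-(n+1)/2}) Q(n) + (1/2) C(n,(n+3)/2) 2^{-(n+3)/2}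 + (1/2) C(n,(n+3)/2)(1 - 2^{-(n+3)/2})(1 - Q(n)) ]. Then the expected average sensitivity E[s^f] of f chosen uniformly from T_2(n) satisfies E[s^f] / \hat{s}_2(n) \to 1 as n \to \infty through odd values. -/

import Mathlib

open Finset

/-- `x` with its `j`-th coordinate set to `b`. -/
def setCoord {n : ℕ} (x : Fin n → Bool) (j : Fin n) (b : Bool) : Fin n → Bool :=
  Function.update x j b

/-- `x` with its `j`-th coordinate flipped (`x ⊕ e_j`). -/
def flipCoord {n : ℕ} (x : Fin n → Bool) (j : Fin n) : Fin n → Bool :=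
  Function.update x j (!x j)

/-- Number of ones of a Boolean vector. -/
def weight {n : ℕ} (x : Fin n → Bool) : ℕ :=
  (Finset.univ.filter fun i => x i = true).card

/-- The activity `α_j^f = 2^{-n} ∑_x (f(x^{(j,0)}) ⊕ f(x^{(j,1)}))`. -/
noncomputable def activity {n : ℕ} (f : (Fin n → Bool) → Bool) (j : Fin n) : ℝ :=
  (2 ^ n : ℝ)⁻¹ * ∑ x : Fin n → Bool,
    (if f (setCoord x j false) ≠ f (setCoord x j true) then (1 : ℝ) else 0)

/-- The sensitivity `s^f(x)` of `f` at `x`. -/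
def sensAt {n : ℕ} (f : (Fin n → Bool) → Bool) (x : Fin n → Bool) : ℕ :=
  (Finset.univ.filter fun i => f (flipCoord x i) ≠ f x).card

/-- The average sensitivity `s^f`. -/
noncomputable def avgSens {n : ℕ} (f : (Fin n → Bool) → Bool) : ℝ :=
  (2 ^ n : ℝ)⁻¹ * ∑ x : Fin n → Bool, (sensAt f x : ℝ)

/-- `x` is a minimal one of the (monotone) function `f`. -/
def MinimalOne {n : ℕ} (f : (Fin n → Bool) → Bool) (x : Fin n → Bool) : Prop :=
  f x = true ∧ ∀ y, y < x → f y = false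

/-- `x` is a maximal zero of the (monotone) function `f`. -/
def MaximalZero {n : ℕ} (f : (Fin n → Bool) → Bool) (x : Fin n → Bool) : Prop :=
  f x = false ∧ ∀ y, x < y → f y = true

/-- The expected average sensitivity of a function drawn uniformly from `T`. -/
noncomputable def expAvgSens {n : ℕ} (T : Finset ((Fin n → Bool) → Bool)) : ℝ :=
  (∑ f ∈ T, avgSens f) / T.card

/-- `r_2 = ⌊C(n,(n-1)/2) 2^{-(n+1)/2}⌋` (for odd `n`). -/
def r2 (n : ℕ) : ℕ := n.choose ((n - 1) / 2) / 2 ^ ((n + 1) / 2)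

/-- `v_2 = ⌊C(n,(n+3)/2) 2^{-(n+3)/2}⌋` (for odd `n`). -/
def v2 (n : ℕ) : ℕ := n.choose ((n + 3) / 2) / 2 ^ ((n + 3) / 2)

/-- `z_2 = ⌊(C(n,(n+1)/2) + r_2 (n-1)/2 - v_2 (n+3)/2)/2⌋` (for odd `n`). -/
def z2 (n : ℕ) : ℤ :=
  ⌊((n.choose ((n + 1) / 2) : ℚ) + (r2 n : ℚ) * (((n - 1) / 2 : ℕ) : ℚ) -
      (v2 n : ℚ) * (((n + 3) / 2 : ℕ) : ℚ)) / 2⌋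

open Classical in
/-- The second class of `typical' monotone Boolean functions for odd `n`: minimal ones only
in layers `(n-1)/2, (n+1)/2, (n+3)/2`, value `1` from layer `(n+5)/2` upward, exactly `r_2`
minimal ones in layer `(n-1)/2`, exactly `v_2` maximal zeros in layer `(n+3)/2`, and value
`1` on exactly `z_2` vertices of layer `(n+1)/2`. -/
noncomputable def typicalOdd2 (n : ℕ) : Finset ((Fin n → Bool) → Bool) :=
  Finset.univ.filter fun f =>
    Monotone f ∧
    (∀ x, MinimalOne f x →
      weight x = (n - 1) / 2 ∨ weight x = (n + 1) / 2 ∨ weight x = (n + 3) / 2) ∧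
    (∀ x, (n + 5) / 2 ≤ weight x → f x = true) ∧
    {x : Fin n → Bool | MinimalOne f x ∧ weight x = (n - 1) / 2}.ncard = r2 n ∧
    {x : Fin n → Bool | MaximalZero f x ∧ weight x = (n + 3) / 2}.ncard = v2 n ∧
    ({x : Fin n → Bool | f x = true ∧ weight x = (n + 1) / 2}.ncard : ℤ) = z2 n

/-- The probability `Q(n)` that a vertex of layer `(n+1)/2` carries the value `1`. -/
noncomputable def Qprob (n : ℕ) : ℝ :=
  ((n.choose ((n + 1) / 2) : ℝ))⁻¹ *
    ((1 / 2) * ((n.choose ((n + 1) / 2) : ℝ) +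
      (n.choose ((n - 1) / 2) : ℝ) * ((2 : ℝ) ^ ((n + 1) / 2))⁻¹ * (((n : ℝ) - 1) / 2) -
      (n.choose ((n + 3) / 2) : ℝ) * ((2 : ℝ) ^ ((n + 3) / 2))⁻¹ * (((n : ℝ) + 3) / 2)))

/-- `ŝ_2(n)`, the asymptotic expected average sensitivity for the second odd class. -/
noncomputable def s2hat (n : ℕ) : ℝ :=
  (n : ℝ) * (2 : ℝ) ^ (1 - (n : ℤ)) *
    ((1 / 2) * (n.choose ((n - 1) / 2) : ℝ) * ((2 : ℝ) ^ ((n + 1) / 2))⁻¹ +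
     (1 / 2) * (n.choose ((n - 1) / 2) : ℝ) * (1 - ((2 : ℝ) ^ ((n + 1) / 2))⁻¹) * Qprob n +
     (1 / 2) * (n.choose ((n + 3) / 2) : ℝ) * ((2 : ℝ) ^ ((n + 3) / 2))⁻¹ +
     (1 / 2) * (n.choose ((n + 3) / 2) : ℝ) * (1 - ((2 : ℝ) ^ ((n + 3) / 2))⁻¹) *
       (1 - Qprob n))


section Layers

variable {n : ℕ}

/-- The set of coordinates at which a Boolean vector equals one. -/
def onesSet (x : Fin n → Bool) : Finset (Fin n) :=
  Finset.univ.filter fun i => x i = true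

@[simp]
theorem mem_onesSet {x : Fin n → Bool} {i : Fin n} : i ∈ onesSet x ↔ x i = true := by
  simp [onesSet]

theorem card_onesSet (x : Fin n → Bool) : (onesSet x).card = weight x := rfl

theorem onesSet_injective : Function.Injective (onesSet : (Fin n → Bool) → Finset (Fin n)) := by
  intro x y h
  ext i
  have := congrArg (i ∈ ·) h
  simp only [mem_onesSet, eq_iff_iff] at this
  rw [Bool.eq_iff_iff]
  exact this

theorem exists_onesSet_eq (s : Finset (Fin n)) : ∃ x, onesSet x = s :=
  ⟨fun i => decide (i ∈ s), by ext; simp⟩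

theorem onesSet_subset_iff {x y : Fin n → Bool} : onesSet x ⊆ onesSet y ↔ x ≤ y := by
  simp [Finset.subset_iff, Pi.le_def, Bool.le_iff_imp]

theorem onesSet_ssubset_iff {x y : Fin n → Bool} : onesSet x ⊂ onesSet y ↔ x < y := by
  rw [Finset.ssubset_iff_subset_ne, lt_iff_le_and_ne, onesSet_subset_iff,
    onesSet_injective.ne_iff]

theorem weight_le (x : Fin n → Bool) : weight x ≤ n := by
  simpa [card_onesSet] using (onesSet x).card_le_univ

theorem weight_mono {x y : Fin n → Bool} (h : x ≤ y) : weight x ≤ weight y :=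
  Finset.card_le_card (onesSet_subset_iff.2 h)

theorem weight_strictMono {x y : Fin n → Bool} (h : x < y) : weight x < weight y :=
  Finset.card_lt_card (onesSet_ssubset_iff.2 h)

/-- Vectors whose set of ones belongs to a given family are counted by that family. -/
theorem card_filter_onesSet_mem (S : Finset (Finset (Fin n))) :
    (Finset.univ.filter fun x => onesSet x ∈ S).card = S.card := by
  refine Finset.card_bij (fun x _ => onesSet x) (by simp)
    (fun x _ y _ h => onesSet_injective h) fun s hs => ?_
  obtain ⟨x, rfl⟩ := exists_onesSet_eq s
  exact ⟨x, by simpa using hs, rfl⟩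

theorem card_layer (k : ℕ) :
    (Finset.univ.filter fun x : Fin n → Bool => weight x = k).card = n.choose k := by
  have h := card_filter_onesSet_mem (Finset.powersetCard k (Finset.univ : Finset (Fin n)))
  simpa [Finset.mem_powersetCard, card_onesSet] using h

/-- The number of vectors of weight `k` at which `f` takes the value one. -/
def layerOnes (f : (Fin n → Bool) → Bool) (k : ℕ) : ℕ :=
  (Finset.univ.filter fun x => f x = true ∧ weight x = k).card

theorem layerOnes_eq_ncard (f : (Fin n → Bool) → Bool) (k : ℕ) :
    layerOnes f k = {x | f x = true ∧ weight x = k}.ncard := by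
  rw [layerOnes, ← Set.ncard_coe_finset]
  congr 1
  ext
  simp

theorem layerOnes_add_card_zeros (f : (Fin n → Bool) → Bool) (k : ℕ) :
    layerOnes f k + {x | f x = false ∧ weight x = k}.ncard = n.choose k := by
  have h : {x | f x = false ∧ weight x = k}.ncard
      = (Finset.univ.filter fun x => f x = false ∧ weight x = k).card := by
    rw [← Set.ncard_coe_finset]
    congr 1
    ext
    simp
  rw [h, ← card_layer, layerOnes,
    ← Finset.card_filter_add_card_filter_not (s := Finset.univ.filter fun x => weight x = k)
      (fun x => f x = true), Finset.filter_filter, Finset.filter_filter]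
  simp [and_comm]

theorem sum_ite_weight (f : (Fin n → Bool) → Bool) (c : ℕ → ℝ) :
    ∑ x, (if f x = true then c (weight x) else 0)
      = ∑ k ∈ Finset.range (n + 1), (layerOnes f k : ℝ) * c k := by
  rw [← Finset.sum_fiberwise_of_maps_to (g := weight) (t := Finset.range (n + 1))
    fun x _ => Finset.mem_range.2 (Nat.lt_succ_of_le (weight_le x))]
  refine Finset.sum_congr rfl fun k _ => ?_
  rw [← Finset.sum_filter, Finset.filter_filter, layerOnes, ← nsmul_eq_mul,
    ← Finset.sum_const]
  refine Finset.sum_congr ?_ fun x hx => ?_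
  · simp [and_comm]
  · rw [(Finset.mem_filter.1 hx).2.2]

end Layers

section Sensitivity

variable {n : ℕ}

theorem flipCoord_involutive (i : Fin n) :
    Function.Involutive fun x : Fin n → Bool => flipCoord x i := by
  intro x
  simp [flipCoord]

theorem two_mul_weight_sub (x : Fin n → Bool) :
    2 * (weight x : ℝ) - n = ∑ i, (if x i = true then (1 : ℝ) else -1) := by
  have h : ∀ i, (if x i = true then (1 : ℝ) else -1)
      = 2 * (if x i = true then (1 : ℝ) else 0) - 1 := by
    intro i; split_ifs <;> norm_num
  simp_rw [h]
  rw [Finset.sum_sub_distrib, ← Finset.mul_sum, Finset.sum_boole]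
  simp [weight]

theorem ite_flipCoord_ne {f : (Fin n → Bool) → Bool} (hf : Monotone f) (x : Fin n → Bool)
    (i : Fin n) :
    (if f (flipCoord x i) ≠ f x then (1 : ℝ) else 0)
      = (if x i = true then (1 : ℝ) else -1) * (if f x = true then 1 else 0)
        + (if flipCoord x i i = true then (1 : ℝ) else -1)
          * (if f (flipCoord x i) = true then 1 else 0) := by
  cases hx : x i
  · have hle : x ≤ flipCoord x i := by
      rw [flipCoord, le_update_iff]
      simp [hx]
    have h := Bool.le_iff_imp.1 (hf hle)
    cases h1 : f x <;> cases h2 : f (flipCoord x i) <;> simp_all [flipCoord]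
  · have hle : flipCoord x i ≤ x := by
      rw [flipCoord, update_le_iff]
      simp [hx]
    have h := Bool.le_iff_imp.1 (hf hle)
    cases h1 : f x <;> cases h2 : f (flipCoord x i) <;> simp_all [flipCoord]

/-- The total sensitivity of a monotone function depends only on its layer counts. -/
theorem sum_sensAt_eq {f : (Fin n → Bool) → Bool} (hf : Monotone f) :
    ∑ x, (sensAt f x : ℝ)
      = 2 * ∑ k ∈ Finset.range (n + 1), (layerOnes f k : ℝ) * (2 * (k : ℝ) - n) := by
  have h : ∀ x, (sensAt f x : ℝ) = ∑ i, (if f (flipCoord x i) ≠ f x then (1 : ℝ) else 0) := by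
    intro x
    rw [Finset.sum_boole, sensAt]
  rw [← sum_ite_weight f fun k => 2 * (k : ℝ) - n]
  simp_rw [h, ite_flipCoord_ne hf, two_mul_weight_sub]
  rw [Finset.sum_comm]
  have hi : ∀ i : Fin n, ∑ x : Fin n → Bool,
      ((if x i = true then (1 : ℝ) else -1) * (if f x = true then 1 else 0)
        + (if flipCoord x i i = true then (1 : ℝ) else -1)
          * (if f (flipCoord x i) = true then 1 else 0))
      = 2 * ∑ x : Fin n → Bool,
        (if x i = true then (1 : ℝ) else -1) * (if f x = true then 1 else 0) := by
    intro i
    rw [Finset.sum_add_distrib, two_mul]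
    congr 1
    exact (flipCoord_involutive i).bijective.sum_comp fun x : Fin n → Bool =>
      (if x i = true then (1 : ℝ) else -1) * (if f x = true then 1 else 0)
  simp_rw [hi]
  rw [← Finset.mul_sum, Finset.sum_comm]
  congr 1
  refine Finset.sum_congr rfl fun x _ => ?_
  rw [← Finset.sum_mul]
  split_ifs <;> simp

theorem sum_choose_mul_Ico (n j : ℕ) (hj : j ≤ n + 1) :
    ∑ k ∈ Finset.Ico j (n + 1), (n.choose k : ℝ) * (2 * (k : ℝ) - n) = j * n.choose j := by
  have h : ∀ k ∈ Finset.Ico j (n + 1), (n.choose k : ℝ) * (2 * (k : ℝ) - n)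
      = -((((k + 1 : ℕ) : ℝ) * n.choose (k + 1)) - (k : ℝ) * n.choose k) := by
    intro k hk
    have hk' : k ≤ n := Nat.lt_succ_iff.1 (Finset.mem_Ico.1 hk).2
    have := congrArg (Nat.cast (R := ℝ)) (Nat.choose_succ_right_eq n k)
    push_cast [Nat.cast_sub hk'] at this ⊢
    linarith
  rw [Finset.sum_congr rfl h, Finset.sum_neg_distrib,
    Finset.sum_Ico_sub (fun k : ℕ => (k : ℝ) * n.choose k) hj]
  simp

end Sensitivity

section TypicalClass

variable {n m : ℕ}

theorem exists_minimalOne_le {f : (Fin n → Bool) → Bool} {x : Fin n → Bool} (hx : f x = true) :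
    ∃ y ≤ x, MinimalOne f y := by
  obtain ⟨y, hyx, hy⟩ := (Set.toFinite {z | f z = true}).exists_le_minimal hx
  refine ⟨y, hyx, hy.prop, fun z hz => ?_⟩
  by_contra h
  exact hz.not_ge (hy.le_of_le (Bool.eq_true_of_not_eq_false h) hz.le)

theorem mem_typicalOdd2_iff (f : (Fin (2 * m + 1) → Bool) → Bool) :
    f ∈ typicalOdd2 (2 * m + 1) ↔ Monotone f ∧
      (∀ x, MinimalOne f x → weight x = m ∨ weight x = m + 1 ∨ weight x = m + 2) ∧
      (∀ x, m + 3 ≤ weight x → f x = true) ∧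
      {x | MinimalOne f x ∧ weight x = m}.ncard = r2 (2 * m + 1) ∧
      {x | MaximalZero f x ∧ weight x = m + 2}.ncard = v2 (2 * m + 1) ∧
      ({x | f x = true ∧ weight x = m + 1}.ncard : ℤ) = z2 (2 * m + 1) := by
  have h1 : (2 * m + 1 - 1) / 2 = m := by omega
  have h2 : (2 * m + 1 + 1) / 2 = m + 1 := by omega
  have h3 : (2 * m + 1 + 3) / 2 = m + 2 := by omega
  have h4 : (2 * m + 1 + 5) / 2 = m + 3 := by omega
  simp only [typicalOdd2, Finset.mem_filter, Finset.mem_univ, true_and, h1, h2, h3, h4]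

theorem minimalOne_iff_of_weight_eq {f : (Fin n → Bool) → Bool}
    (hmin : ∀ x, MinimalOne f x → m ≤ weight x) {x : Fin n → Bool} (hx : weight x = m) :
    MinimalOne f x ↔ f x = true := by
  refine ⟨fun h => h.1, fun h => ?_⟩
  obtain ⟨y, hyx, hy⟩ := exists_minimalOne_le h
  obtain rfl | hlt := hyx.eq_or_lt
  · exact hy
  · have := weight_strictMono hlt
    have := hmin y hy
    omega

theorem maximalZero_iff_of_weight_eq {f : (Fin n → Bool) → Bool}
    (htop : ∀ x, m + 1 ≤ weight x → f x = true) {x : Fin n → Bool} (hx : weight x = m) :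
    MaximalZero f x ↔ f x = false := by
  refine ⟨fun h => h.1, fun h => ⟨h, fun y hy => htop y ?_⟩⟩
  have := weight_strictMono hy
  omega

/-- All members of the class have the same average sensitivity. -/
theorem avgSens_of_mem_typicalOdd2 (hm : 1 ≤ m) {f : (Fin (2 * m + 1) → Bool) → Bool}
    (hf : f ∈ typicalOdd2 (2 * m + 1)) :
    avgSens f = (2 ^ (2 * m + 1) : ℝ)⁻¹ * (2 * ((z2 (2 * m + 1) : ℝ) - r2 (2 * m + 1)
      - 3 * v2 (2 * m + 1) + (m + 2 : ℕ) * (2 * m + 1).choose (m + 2))) := by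
  obtain ⟨hmono, hmin, htop, hr, hv, hz⟩ := (mem_typicalOdd2_iff f).1 hf
  have hmin' : ∀ x, MinimalOne f x → m ≤ weight x := fun x hx => by
    have := hmin x hx
    omega
  have hlow : ∀ k < m, layerOnes f k = 0 := by
    intro k hk
    rw [layerOnes, Finset.card_eq_zero, Finset.filter_eq_empty_iff]
    rintro x - ⟨hx, rfl⟩
    obtain ⟨y, hyx, hy⟩ := exists_minimalOne_le hx
    have := hmin' y hy
    have := weight_mono hyx
    omega
  have hbot : layerOnes f m = r2 (2 * m + 1) := by
    rw [← hr, layerOnes_eq_ncard]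
    congr 1
    ext x
    exact and_congr_left fun hx => (minimalOne_iff_of_weight_eq hmin' hx).symm
  have hmid : (layerOnes f (m + 1) : ℝ) = z2 (2 * m + 1) := by
    rw [← hz, layerOnes_eq_ncard]
    simp
  have hupp : (layerOnes f (m + 2) : ℝ)
      = (2 * m + 1).choose (m + 2) - v2 (2 * m + 1) := by
    rw [← layerOnes_add_card_zeros f (m + 2), ← hv]
    have : {x | MaximalZero f x ∧ weight x = m + 2} = {x | f x = false ∧ weight x = m + 2} := by
      ext x
      exact and_congr_left fun hx => maximalZero_iff_of_weight_eq htop hx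
    rw [this]
    push_cast
    ring
  have hhigh : ∀ k, m + 3 ≤ k → layerOnes f k = (2 * m + 1).choose k := by
    intro k hk
    rw [layerOnes, ← card_layer]
    congr 1
    ext x
    simp only [Finset.mem_filter, Finset.mem_univ, true_and, and_iff_right_iff_imp]
    rintro rfl
    exact htop x hk
  have hsum := sum_choose_mul_Ico (2 * m + 1) (m + 2) (by omega)
  rw [Finset.sum_eq_sum_Ico_succ_bot (by omega)] at hsum
  rw [avgSens, sum_sensAt_eq hmono, Finset.range_eq_Ico,
    ← Finset.sum_Ico_consecutive _ (Nat.zero_le m) (by omega),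
    Finset.sum_eq_zero fun k hk => by rw [hlow k (Finset.mem_Ico.1 hk).2]; simp,
    Finset.sum_eq_sum_Ico_succ_bot (by omega), Finset.sum_eq_sum_Ico_succ_bot (by omega),
    Finset.sum_eq_sum_Ico_succ_bot (by omega),
    Finset.sum_congr rfl fun k hk => by rw [hhigh k (Finset.mem_Ico.1 hk).1], hbot, hmid, hupp,
    ← hsum]
  congr 2
  push_cast
  ring

end TypicalClass

section Existence

variable {n m : ℕ}

open Classical in
/-- The function that is one on the families `A`, `Z` of sets, on the sets of size `m + 2`
outside `B`, and on all sets of size at least `m + 3`. -/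
noncomputable def layeredFun (m : ℕ) (A Z B : Finset (Finset (Fin n))) (x : Fin n → Bool) : Bool :=
  decide (onesSet x ∈ A ∨ onesSet x ∈ Z ∨ (weight x = m + 2 ∧ onesSet x ∉ B) ∨ m + 3 ≤ weight x)

variable {A Z B : Finset (Finset (Fin n))}

theorem layeredFun_eq_true {x : Fin n → Bool} : layeredFun m A Z B x = true ↔
    onesSet x ∈ A ∨ onesSet x ∈ Z ∨ (weight x = m + 2 ∧ onesSet x ∉ B) ∨ m + 3 ≤ weight x := by
  simp [layeredFun]

theorem monotone_layeredFun (hZ : ∀ s ∈ Z, s.card = m + 1)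
    (hAZ : A.upShadow ⊆ Z) (hZB : Disjoint Z B.shadow) : Monotone (layeredFun m A Z B) := by
  have key : Monotone fun s : Finset (Fin n) =>
      s ∈ A ∨ s ∈ Z ∨ (s.card = m + 2 ∧ s ∉ B) ∨ m + 3 ≤ s.card := by
    rw [monotone_iff_forall_covBy]
    intro s t hst
    obtain ⟨a, ha, rfl⟩ := Finset.covBy_iff_exists_insert.1 hst
    have hcard := Finset.card_insert_of_notMem ha
    rintro (h | h | h | h)
    · exact Or.inr (Or.inl (hAZ (Finset.insert_mem_upShadow h ha)))
    · refine Or.inr (Or.inr (Or.inl ⟨by rw [hcard, hZ s h], fun hB => ?_⟩))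
      refine Finset.disjoint_left.1 hZB h ?_
      simpa [ha] using Finset.erase_mem_shadow hB (Finset.mem_insert_self a s)
    · exact Or.inr (Or.inr (Or.inr (by omega)))
    · exact Or.inr (Or.inr (Or.inr (by omega)))
  intro x y hxy
  rw [Bool.le_iff_imp, layeredFun_eq_true, layeredFun_eq_true]
  exact key (onesSet_subset_iff.2 hxy)

theorem ncard_onesSet_mem (S : Finset (Finset (Fin n))) :
    {x | onesSet x ∈ S}.ncard = S.card := by
  rw [← card_filter_onesSet_mem, ← Set.ncard_coe_finset]
  congr 1
  ext
  simp

theorem layeredFun_mem_typicalOdd2 {A Z B : Finset (Finset (Fin (2 * m + 1)))}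
    (hA : ∀ s ∈ A, s.card = m) (hZ : ∀ s ∈ Z, s.card = m + 1) (hB : ∀ s ∈ B, s.card = m + 2)
    (hAZ : A.upShadow ⊆ Z) (hZB : Disjoint Z B.shadow) {i : Fin (2 * m + 1)}
    (hiB : ∀ s ∈ B, i ∈ s) (hAcard : A.card = r2 (2 * m + 1)) (hBcard : B.card = v2 (2 * m + 1))
    (hZcard : (Z.card : ℤ) = z2 (2 * m + 1)) :
    layeredFun m A Z B ∈ typicalOdd2 (2 * m + 1) := by
  have hmin : ∀ x, MinimalOne (layeredFun m A Z B) x → m ≤ weight x := by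
    rintro x ⟨hx, -⟩
    rcases layeredFun_eq_true.1 hx with h | h | h | h
    · exact (hA _ h).ge
    · exact (Nat.le_succ m).trans (hZ _ h).ge
    · omega
    · omega
  have htop : ∀ x, m + 3 ≤ weight x → layeredFun m A Z B x = true := fun x hx =>
    layeredFun_eq_true.2 (Or.inr (Or.inr (Or.inr hx)))
  refine (mem_typicalOdd2_iff _).2
    ⟨monotone_layeredFun hZ hAZ hZB, fun x hx => ?_, htop, ?_, ?_, ?_⟩
  · have hle := hmin x hx
    suffices weight x < m + 3 by omega
    by_contra! hge
    -- a proper subset of size at least `m + 2` outside `B` carries the value one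
    obtain ⟨j, hj, hjB⟩ : ∃ j ∈ onesSet x, (onesSet x).erase j ∉ B := by
      by_cases hi : i ∈ onesSet x
      · exact ⟨i, hi, fun h => by simpa using hiB _ h⟩
      · obtain ⟨j, hj⟩ : (onesSet x).Nonempty := by
          rw [← Finset.card_pos, card_onesSet]
          omega
        exact ⟨j, hj, fun h => hi (Finset.mem_of_mem_erase (hiB _ h))⟩
    obtain ⟨y, hy⟩ := exists_onesSet_eq ((onesSet x).erase j)
    have hyx : y < x := onesSet_ssubset_iff.1 (hy ▸ Finset.erase_ssubset hj)
    have hcard : weight y = weight x - 1 := by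
      rw [← card_onesSet, hy, Finset.card_erase_of_mem hj, card_onesSet]
    have htrue : layeredFun m A Z B y = true := by
      rw [layeredFun_eq_true, hy]
      by_cases h : weight y = m + 2
      · exact Or.inr (Or.inr (Or.inl ⟨h, hjB⟩))
      · exact Or.inr (Or.inr (Or.inr (by omega)))
    rw [hx.2 y hyx] at htrue
    exact Bool.false_ne_true htrue
  · rw [← hAcard, ← ncard_onesSet_mem]
    congr 1
    ext x
    constructor
    · rintro ⟨hx, hw⟩
      rcases layeredFun_eq_true.1 hx.1 with h | h | h | h
      · exact h
      · have := hZ _ h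
        rw [card_onesSet] at this
        omega
      · omega
      · omega
    · intro hx
      have hw : weight x = m := hA _ hx
      exact ⟨(minimalOne_iff_of_weight_eq hmin hw).2 (layeredFun_eq_true.2 (Or.inl hx)), hw⟩
  · rw [← hBcard, ← ncard_onesSet_mem]
    congr 1
    ext x
    constructor
    · rintro ⟨hx, hw⟩
      by_contra h
      have htrue : layeredFun m A Z B x = true :=
        layeredFun_eq_true.2 (Or.inr (Or.inr (Or.inl ⟨hw, h⟩)))
      rw [hx.1] at htrue
      exact Bool.false_ne_true htrue
    · intro hx
      have hw : weight x = m + 2 := hB _ hx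
      refine ⟨(maximalZero_iff_of_weight_eq htop hw).2 ?_, hw⟩
      rw [← Bool.not_eq_true, layeredFun_eq_true]
      rintro (h | h | h | h)
      · have := hA _ h
        rw [card_onesSet] at this
        omega
      · have := hZ _ h
        rw [card_onesSet] at this
        omega
      · exact h.2 hx
      · omega
  · rw [← hZcard, ← ncard_onesSet_mem]
    congr 2
    ext x
    constructor
    · rintro ⟨hx, hw⟩
      rcases layeredFun_eq_true.1 hx with h | h | h | h
      · have := hA _ h
        rw [card_onesSet] at this
        omega
      · exact h
      · omega
      · omega
    · intro hx
      exact ⟨layeredFun_eq_true.2 (Or.inr (Or.inl hx)), hZ _ hx⟩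

theorem card_upShadow_le {k : ℕ} (hA : ∀ s ∈ A, s.card = k) :
    A.upShadow.card ≤ A.card * (n - k) := by
  rw [Finset.upShadow, Finset.sup_eq_biUnion]
  refine Finset.card_biUnion_le_card_mul _ _ _ fun s hs => Finset.card_image_le.trans ?_
  rw [Finset.card_compl, Fintype.card_fin, hA s hs]

theorem card_shadow_le {k : ℕ} (hB : ∀ s ∈ B, s.card = k) :
    B.shadow.card ≤ B.card * k := by
  rw [Finset.shadow, Finset.sup_eq_biUnion]
  refine Finset.card_biUnion_le_card_mul _ _ _ fun s hs => Finset.card_image_le.trans ?_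
  rw [hB s hs]

/-- Small families of sets of size `k + 1` through a point `p` and otherwise inside `t` exist. -/
theorem exists_family_insert {α : Type*} [DecidableEq α] {t : Finset α} {p : α} (hp : p ∉ t)
    {k c : ℕ} (hc : c ≤ t.card.choose k) :
    ∃ S : Finset (Finset α), S.card = c ∧ ∀ s ∈ S, s.card = k + 1 ∧ p ∈ s ∧ s ⊆ insert p t := by
  have hcard : ((t.powersetCard k).image (insert p)).card = t.card.choose k := by
    rw [Finset.card_image_of_injOn, Finset.card_powersetCard]
    intro a ha b hb hab
    have ha' : p ∉ a := fun h => hp ((Finset.mem_powersetCard.1 ha).1 h)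
    have hb' : p ∉ b := fun h => hp ((Finset.mem_powersetCard.1 hb).1 h)
    rw [← Finset.erase_insert ha', ← Finset.erase_insert hb']
    exact congrArg (Finset.erase · p) hab
  obtain ⟨S, hS, hSc⟩ := Finset.exists_subset_card_eq (hcard.symm ▸ hc)
  refine ⟨S, hSc, fun s hs => ?_⟩
  obtain ⟨a, ha, rfl⟩ := Finset.mem_image.1 (hS hs)
  obtain ⟨hat, hac⟩ := Finset.mem_powersetCard.1 ha
  exact ⟨by rw [Finset.card_insert_of_notMem fun h => hp (hat h), hac],
    Finset.mem_insert_self p a, Finset.insert_subset_insert p hat⟩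

end Existence

section Counts

variable {m : ℕ}

theorem choose_middle_succ (m : ℕ) : (2 * m + 1).choose (m + 1) = (2 * m + 1).choose m :=
  Nat.choose_symm_half m

theorem r2_odd (m : ℕ) : r2 (2 * m + 1) = (2 * m + 1).choose (m + 1) / 2 ^ (m + 1) := by
  have h1 : (2 * m + 1 - 1) / 2 = m := by omega
  have h2 : (2 * m + 1 + 1) / 2 = m + 1 := by omega
  rw [r2, h1, h2, choose_middle_succ]

theorem v2_odd (m : ℕ) : v2 (2 * m + 1) = (2 * m + 1).choose (m + 2) / 2 ^ (m + 2) := by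
  have h3 : (2 * m + 1 + 3) / 2 = m + 2 := by omega
  rw [v2, h3]

theorem z2_odd (m : ℕ) : z2 (2 * m + 1) = ⌊(((2 * m + 1).choose (m + 1) : ℚ)
    + r2 (2 * m + 1) * m - v2 (2 * m + 1) * (m + 2)) / 2⌋ := by
  have h1 : (2 * m + 1 - 1) / 2 = m := by omega
  have h2 : (2 * m + 1 + 1) / 2 = m + 1 := by omega
  have h3 : (2 * m + 1 + 3) / 2 = m + 2 := by omega
  rw [z2, h1, h2, h3]
  push_cast
  rfl

theorem choose_add_two_mul (m : ℕ) :
    (2 * m + 1).choose (m + 2) * (m + 2) = (2 * m + 1).choose (m + 1) * m := by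
  rw [Nat.choose_succ_right_eq]
  congr 1
  omega

theorem choose_add_two_le (m : ℕ) :
    (2 * m + 1).choose (m + 2) ≤ (2 * m + 1).choose (m + 1) := by
  have := choose_add_two_mul m
  nlinarith

theorem r2_le_choose (hm : 2 ≤ m) : r2 (2 * m + 1) ≤ (2 * m).choose (m - 1) := by
  obtain ⟨k, rfl⟩ := Nat.exists_eq_add_of_le' hm
  rw [r2_odd, choose_middle_succ]
  refine Nat.div_le_of_le_mul ?_
  have h1 : (2 * (k + 2) + 1).choose (k + 2)
      = (2 * (k + 2)).choose (k + 1) + (2 * (k + 2)).choose (k + 2) := Nat.choose_succ_succ _ _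
  have h2 := Nat.choose_succ_right_eq (2 * (k + 2)) (k + 1)
  have h3 : 2 * (k + 2) - (k + 1) = k + 3 := by omega
  have h4 : (2 * (k + 2)).choose (k + 2) ≤ 2 * (2 * (k + 2)).choose (k + 1) := by
    rw [h3] at h2
    nlinarith
  have h5 : 2 ^ 3 ≤ 2 ^ (k + 2 + 1) := Nat.pow_le_pow_right (by norm_num) (by omega)
  change _ ≤ _ * (2 * (k + 2)).choose (k + 1)
  nlinarith

theorem v2_le_choose (hm : 2 ≤ m) : v2 (2 * m + 1) ≤ (2 * m - 1).choose (m + 1) := by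
  obtain ⟨k, rfl⟩ := Nat.exists_eq_add_of_le' hm
  rw [v2_odd]
  refine Nat.div_le_of_le_mul ?_
  have h0 : 2 * (k + 2) - 1 = 2 * k + 3 := by omega
  rw [h0]
  have h1 : (2 * k + 4 + 1) * (2 * k + 4).choose (k + 3)
      = (2 * k + 4 + 1).choose (k + 3 + 1) * (k + 3 + 1) := Nat.add_one_mul_choose_eq _ _
  have h2 : (2 * k + 3 + 1).choose (k + 2 + 1)
      = (2 * k + 3).choose (k + 2) + (2 * k + 3).choose (k + 3) := Nat.choose_succ_succ _ _
  have h3 := Nat.choose_succ_right_eq (2 * k + 3) (k + 2)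
  have h4 : 2 * k + 3 - (k + 2) = k + 1 := by omega
  rw [h4] at h3
  have h5 : (2 * k + 3).choose (k + 2) ≤ 3 * (2 * k + 3).choose (k + 3) := by
    change (2 * k + 3).choose (k + 3) * (k + 3) = _ at h3
    nlinarith
  have h6 : (2 * k + 5).choose (k + 4) ≤ 2 * (2 * k + 4).choose (k + 3) := by
    change _ = (2 * k + 5).choose (k + 4) * (k + 4) at h1
    nlinarith
  have h7 : 2 ^ 4 ≤ 2 ^ (k + 2 + 2) := Nat.pow_le_pow_right (by norm_num) (by omega)
  have h8 : (2 * k + 4).choose (k + 3) ≤ 4 * (2 * k + 3).choose (k + 3) := by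
    change (2 * k + 4).choose (k + 3) = _ at h2
    omega
  change (2 * k + 5).choose (k + 4) ≤ _
  nlinarith

theorem add_two_le_two_pow (hm : 2 ≤ m) : m + 2 ≤ 2 ^ m := by
  induction m, hm using Nat.le_induction with
  | base => norm_num
  | succ k hk ih =>
    rw [pow_succ]
    omega

theorem r2_add_v2_mul_le (hm : 2 ≤ m) :
    (r2 (2 * m + 1) + v2 (2 * m + 1)) * (m + 2) ≤ (2 * m + 1).choose (m + 1) := by
  have hr : r2 (2 * m + 1) * 2 ^ (m + 1) ≤ (2 * m + 1).choose (m + 1) := by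
    rw [r2_odd]
    exact Nat.div_mul_le_self _ _
  have hv : v2 (2 * m + 1) * 2 ^ (m + 2) ≤ (2 * m + 1).choose (m + 2) := by
    rw [v2_odd]
    exact Nat.div_mul_le_self _ _
  have hC := choose_add_two_le m
  have hpow := add_two_le_two_pow hm
  rw [pow_succ] at hr
  rw [pow_add] at hv
  nlinarith [Nat.zero_le (v2 (2 * m + 1) * 2 ^ m), Nat.mul_le_mul_left
    (r2 (2 * m + 1) + v2 (2 * m + 1)) hpow]

theorem r2_mul_le_z2 (hm : 2 ≤ m) : ((r2 (2 * m + 1) * (m + 1) : ℕ) : ℤ) ≤ z2 (2 * m + 1) := by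
  have h : (((r2 (2 * m + 1) + v2 (2 * m + 1)) * (m + 2) : ℕ) : ℚ)
      ≤ (2 * m + 1).choose (m + 1) := by exact_mod_cast r2_add_v2_mul_le hm
  rw [z2_odd, Int.le_floor]
  push_cast at h ⊢
  linarith

theorem z2_add_v2_mul_le (hm : 2 ≤ m) :
    z2 (2 * m + 1) + ((v2 (2 * m + 1) * (m + 2) : ℕ) : ℤ) ≤ (2 * m + 1).choose (m + 1) := by
  have h : (((r2 (2 * m + 1) + v2 (2 * m + 1)) * (m + 2) : ℕ) : ℚ)
      ≤ (2 * m + 1).choose (m + 1) := by exact_mod_cast r2_add_v2_mul_le hm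
  have hz := Int.floor_le ((((2 * m + 1).choose (m + 1) : ℚ)
    + r2 (2 * m + 1) * m - v2 (2 * m + 1) * (m + 2)) / 2)
  rw [← z2_odd] at hz
  have hr : (0 : ℚ) ≤ r2 (2 * m + 1) := Nat.cast_nonneg _
  push_cast at h
  suffices h' : (z2 (2 * m + 1) : ℚ) + v2 (2 * m + 1) * (m + 2)
      ≤ (2 * m + 1).choose (m + 1) by exact_mod_cast h'
  linarith

theorem typicalOdd2_nonempty (hm : 2 ≤ m) : (typicalOdd2 (2 * m + 1)).Nonempty := by
  have hpq : (⟨0, by omega⟩ : Fin (2 * m + 1)) ≠ ⟨1, by omega⟩ := by simp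
  generalize (⟨0, by omega⟩ : Fin (2 * m + 1)) = p at hpq
  generalize (⟨1, by omega⟩ : Fin (2 * m + 1)) = q at hpq
  have hAc : r2 (2 * m + 1) ≤ (Finset.univ.erase p).card.choose (m - 1) := by
    simpa using r2_le_choose hm
  have hBc : v2 (2 * m + 1) ≤ ((Finset.univ.erase p).erase q).card.choose (m + 1) := by
    have hq : q ∈ Finset.univ.erase p := by simp [hpq.symm]
    simpa [Finset.card_erase_of_mem hq] using v2_le_choose hm
  obtain ⟨A, hAcard, hA⟩ := exists_family_insert (Finset.notMem_erase p _) hAc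
  obtain ⟨B, hBcard, hB⟩ := exists_family_insert (Finset.notMem_erase q _) hBc
  have hAm : ∀ s ∈ A, s.card = m := fun s hs => by
    have := (hA s hs).1
    omega
  have hBm : ∀ s ∈ B, s.card = m + 2 := fun s hs => (hB s hs).1
  have hpB : ∀ s ∈ B, p ∉ s := fun s hs h => by
    have := (hB s hs).2.2 h
    simp [hpq] at this
  have hsub : A.upShadow ⊆
      Finset.powersetCard (m + 1) (Finset.univ : Finset (Fin (2 * m + 1))) \ B.shadow := by
    intro s hs
    obtain ⟨a, ha, i, hi, rfl⟩ := Finset.mem_upShadow_iff.1 hs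
    rw [Finset.mem_sdiff, Finset.mem_powersetCard]
    refine ⟨⟨Finset.subset_univ _, by rw [Finset.card_insert_of_notMem hi, hAm a ha]⟩, ?_⟩
    intro hmem
    obtain ⟨b, hb, j, hj, hbj⟩ := Finset.mem_shadow_iff.1 hmem
    refine hpB b hb (Finset.mem_of_mem_erase (a := j) ?_)
    rw [hbj]
    exact Finset.mem_insert_of_mem (hA a ha).2.1
  obtain ⟨z, hz⟩ := Int.eq_ofNat_of_zero_le ((Int.natCast_nonneg _).trans (r2_mul_le_z2 hm))
  have hlow : A.upShadow.card ≤ z := by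
    have h1 := card_upShadow_le hAm
    have h2 := r2_mul_le_z2 hm
    rw [hz] at h2
    rw [hAcard, show 2 * m + 1 - m = m + 1 by omega] at h1
    exact h1.trans (by exact_mod_cast h2)
  have hupp : z ≤
      (Finset.powersetCard (m + 1) (Finset.univ : Finset (Fin (2 * m + 1))) \ B.shadow).card := by
    have h1 := card_shadow_le hBm
    have h2 := z2_add_v2_mul_le hm
    have h3 := Finset.le_card_sdiff B.shadow
      (Finset.powersetCard (m + 1) (Finset.univ : Finset (Fin (2 * m + 1))))
    rw [Finset.card_powersetCard, Finset.card_univ, Fintype.card_fin] at h3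
    rw [hz] at h2
    rw [hBcard] at h1
    have h4 : z + v2 (2 * m + 1) * (m + 2) ≤ (2 * m + 1).choose (m + 1) := by exact_mod_cast h2
    omega
  obtain ⟨Z, hAZ, hZ, hZcard⟩ := Finset.exists_subsuperset_card_eq hsub hlow hupp
  exact ⟨_, layeredFun_mem_typicalOdd2 hAm
    (fun s hs => (Finset.mem_powersetCard.1 (Finset.mem_sdiff.1 (hZ hs)).1).2) hBm hAZ
    (Finset.disjoint_left.2 fun s hs => (Finset.mem_sdiff.1 (hZ hs)).2)
    (fun s hs => (hB s hs).2.1) hAcard hBcard (by rw [hZcard, hz])⟩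

end Counts

section Asymptotics

open Filter Topology

variable {m : ℕ}

/-- The relative size of the contribution of the sparse layers to the average sensitivity. -/
noncomputable def sparseRatio (m : ℕ) : ℝ :=
  ((z2 (2 * m + 1) : ℝ) - r2 (2 * m + 1) - 3 * v2 (2 * m + 1)) / (2 * m + 1).choose (m + 1)

theorem choose_middle_pos (m : ℕ) : (0 : ℝ) < (2 * m + 1).choose (m + 1) := by
  exact_mod_cast Nat.choose_pos (by omega)

theorem expAvgSens_typicalOdd2 (hm : 2 ≤ m) : expAvgSens (typicalOdd2 (2 * m + 1))
    = (2 ^ (2 * m + 1) : ℝ)⁻¹ * 2 * (2 * m + 1).choose (m + 1) * (m + sparseRatio m) := by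
  have hcard : ((typicalOdd2 (2 * m + 1)).card : ℝ) ≠ 0 := by
    exact_mod_cast (typicalOdd2_nonempty hm).card_pos.ne'
  have hC := (choose_middle_pos m).ne'
  have h : ((m + 2 : ℕ) : ℝ) * (2 * m + 1).choose (m + 2) = (2 * m + 1).choose (m + 1) * m := by
    rw [mul_comm]
    exact_mod_cast choose_add_two_mul m
  rw [expAvgSens, Finset.sum_congr rfl fun f hf => avgSens_of_mem_typicalOdd2 (by omega) hf,
    Finset.sum_const, nsmul_eq_mul, mul_div_cancel_left₀ _ hcard, h, sparseRatio]
  field_simp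
  ring

theorem abs_sparseRatio_le (hm : 2 ≤ m) : |sparseRatio m| ≤ 5 := by
  have h1 : (((r2 (2 * m + 1) + v2 (2 * m + 1)) * (m + 2) : ℕ) : ℝ)
      ≤ (2 * m + 1).choose (m + 1) := by exact_mod_cast r2_add_v2_mul_le hm
  have h2 : (((r2 (2 * m + 1) * (m + 1) : ℕ) : ℤ) : ℝ) ≤ z2 (2 * m + 1) := by
    exact_mod_cast r2_mul_le_z2 hm
  have h3 : (z2 (2 * m + 1) : ℝ) + (((v2 (2 * m + 1) * (m + 2) : ℕ) : ℤ) : ℝ)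
      ≤ (2 * m + 1).choose (m + 1) := by exact_mod_cast z2_add_v2_mul_le hm
  push_cast at h1 h2 h3
  have hr : (0 : ℝ) ≤ r2 (2 * m + 1) := Nat.cast_nonneg _
  have hv : (0 : ℝ) ≤ v2 (2 * m + 1) := Nat.cast_nonneg _
  have hrm : (0 : ℝ) ≤ r2 (2 * m + 1) * m := by positivity
  have hvm : (0 : ℝ) ≤ v2 (2 * m + 1) * m := by positivity
  have hC := choose_middle_pos m
  rw [sparseRatio, abs_div, abs_of_pos hC, div_le_iff₀ hC, abs_le]
  constructor <;> nlinarith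

/-- The limiting probability of value one on the middle layer, in terms of `m = (n - 1) / 2`. -/
noncomputable def middleProb (m : ℕ) : ℝ := (1 + m * (1 / 2) ^ m / 4) / 2

theorem Qprob_odd (m : ℕ) : Qprob (2 * m + 1) = middleProb m := by
  have h1 : (2 * m + 1 - 1) / 2 = m := by omega
  have h2 : (2 * m + 1 + 1) / 2 = m + 1 := by omega
  have h3 : (2 * m + 1 + 3) / 2 = m + 2 := by omega
  have hC := (choose_middle_pos m).ne'
  have h : ((2 * m + 1).choose (m + 2) : ℝ) = (2 * m + 1).choose (m + 1) * (m / (m + 2)) := by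
    rw [mul_div_assoc', eq_div_iff (by positivity)]
    exact_mod_cast choose_add_two_mul m
  rw [Qprob, h1, h2, h3, ← choose_middle_succ, h, middleProb, one_div, inv_pow]
  push_cast
  field_simp
  ring

/-- The bracket in the definition of `s2hat`, normalised to tend to one. -/
noncomputable def layerFactor (m : ℕ) : ℝ :=
  (1 / 2) ^ m / 2 + (1 - (1 / 2) ^ m / 2) * middleProb m
    + (m : ℝ) / (m + 2) * ((1 / 2) ^ m / 4 + (1 - (1 / 2) ^ m / 4) * (1 - middleProb m))

theorem s2hat_odd (m : ℕ) : s2hat (2 * m + 1)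
    = (2 ^ (2 * m + 1) : ℝ)⁻¹ * 2 * (2 * m + 1).choose (m + 1) * ((m + 1 / 2) * layerFactor m) := by
  have h1 : (2 * m + 1 - 1) / 2 = m := by omega
  have h2 : (2 * m + 1 + 1) / 2 = m + 1 := by omega
  have h3 : (2 * m + 1 + 3) / 2 = m + 2 := by omega
  have h : ((2 * m + 1).choose (m + 2) : ℝ) = (2 * m + 1).choose (m + 1) * (m / (m + 2)) := by
    rw [mul_div_assoc', eq_div_iff (by positivity)]
    exact_mod_cast choose_add_two_mul m
  have hpow : (2 : ℝ) ^ (1 - ((2 * m + 1 : ℕ) : ℤ)) = (2 ^ (2 * m + 1) : ℝ)⁻¹ * 2 := by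
    rw [zpow_sub₀ two_ne_zero, zpow_one, zpow_natCast, div_eq_inv_mul]
  have e1 : ((2 : ℝ) ^ (m + 1))⁻¹ = (1 / 2) ^ m / 2 := by
    rw [pow_succ, mul_inv, one_div, inv_pow]
    ring
  have e2 : ((2 : ℝ) ^ (m + 2))⁻¹ = (1 / 2) ^ m / 4 := by
    rw [pow_add, mul_inv, one_div, inv_pow]
    ring
  rw [s2hat, h1, h2, h3, Qprob_odd, ← choose_middle_succ, h, hpow, e1, e2, layerFactor]
  push_cast
  ring

theorem tendsto_middleProb : Tendsto middleProb atTop (𝓝 (1 / 2)) := by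
  have h := tendsto_self_mul_const_pow_of_lt_one (r := (1 / 2 : ℝ)) (by norm_num) (by norm_num)
  have h' := ((h.div_const 4).const_add 1).div_const 2
  rwa [zero_div, add_zero] at h'

theorem tendsto_layerFactor : Tendsto layerFactor atTop (𝓝 1) := by
  have he : Tendsto (fun m : ℕ => (1 / 2 : ℝ) ^ m) atTop (𝓝 0) :=
    tendsto_pow_atTop_nhds_zero_of_lt_one (by norm_num) (by norm_num)
  have hρ : Tendsto (fun m : ℕ => (m : ℝ) / (m + 2)) atTop (𝓝 1) :=
    tendsto_natCast_div_add_atTop 2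
  have h := ((he.div_const 2).add (((he.div_const 2).const_sub 1).mul tendsto_middleProb)).add
    (hρ.mul ((he.div_const 4).add
      (((he.div_const 4).const_sub 1).mul (tendsto_middleProb.const_sub 1))))
  have hlim : (0 / 2 + (1 - 0 / 2) * (1 / 2) + 1 * (0 / 4 + (1 - 0 / 4) * (1 - 1 / 2)) : ℝ) = 1 := by
    norm_num
  rwa [hlim] at h

theorem tendsto_add_sparseRatio_div :
    Tendsto (fun m : ℕ => ((m : ℝ) + sparseRatio m) / ((m + 1 / 2) * layerFactor m))
      atTop (𝓝 1) := by
  have hm : Tendsto (fun m : ℕ => (m : ℝ) / (m + 1 / 2)) atTop (𝓝 1) :=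
    tendsto_natCast_div_add_atTop (1 / 2)
  have hδ : Tendsto (fun m : ℕ => sparseRatio m / (m + 1 / 2)) atTop (𝓝 0) := by
    have htop : Tendsto (fun m : ℕ => (m : ℝ) + 1 / 2) atTop atTop :=
      tendsto_atTop_add_const_right _ _ tendsto_natCast_atTop_atTop
    refine squeeze_zero_norm' ?_ (htop.const_div_atTop 5)
    filter_upwards [eventually_ge_atTop 2] with m hm
    have hpos : (0 : ℝ) < m + 1 / 2 := by positivity
    rw [norm_div, Real.norm_eq_abs, Real.norm_of_nonneg hpos.le]
    gcongr
    exact abs_sparseRatio_le hm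
  have h := (hm.add hδ).div tendsto_layerFactor one_ne_zero
  simp only [add_zero, div_one] at h
  refine h.congr fun m => ?_
  rw [Pi.div_apply, ← add_div, div_div]

end Asymptotics

/-- odd case, second class: `E[s^f] ∼ ŝ_2(n)` as `n → ∞` through odd
values, for `f` uniform on the second class of typical monotone Boolean functions. -/
theorem expected_avgSens_odd_second :
    Filter.Tendsto (fun n : ℕ => expAvgSens (typicalOdd2 n) / s2hat n)
      (Filter.atTop ⊓ Filter.principal {n : ℕ | Odd n}) (nhds 1) := by
  have hhalf : Filter.Tendsto (fun n : ℕ => n / 2)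
      (Filter.atTop ⊓ Filter.principal {n : ℕ | Odd n}) Filter.atTop :=
    (Nat.tendsto_div_const_atTop two_ne_zero).mono_left inf_le_left
  refine (tendsto_add_sparseRatio_div.comp hhalf).congr' ?_
  have hodd : ∀ᶠ n : ℕ in Filter.atTop ⊓ Filter.principal {n : ℕ | Odd n}, Odd n :=
    Filter.mem_inf_of_right (Filter.mem_principal_self _)
  filter_upwards [hodd, hhalf.eventually_ge_atTop 2] with n ⟨m, hn⟩ hge
  subst hn
  have hdiv : (2 * m + 1) / 2 = m := by omega
  rw [hdiv] at hge
  have hC := (choose_middle_pos m).ne'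
  rw [Function.comp_apply, hdiv, expAvgSens_typicalOdd2 hge, s2hat_odd, mul_div_mul_left]
  positivity
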